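/- The min-max objective J(ν,ζ) has a saddle point: the pair (ν*, w), where ν* is the unique solution of ν = w + B^π ν, satisfies J(ν*, ζ) ≤ J(ν*, w) ≤ J(ν, w) for all ν, ζ : S × A → ℝ. Moreover, every saddle point (ν*, ζ*) of J(ν,ζ) satisfies ζ*(s,a) = w(s,a) for every (s,a) ∈ S × A. -/

import Mathlib

open scoped BigOperators

/-- The t-step state distributions: `betaT T pi beta 0 = beta` and
`betaT T pi beta (t+1) s' = ∑ s, ∑ a, betaT T pi beta t s * pi s a * T s a s'`. -/
def betaT {S A : Type*} [Fintype S] [Fintype A]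
    (T : S → A → S → ℝ) (pi : S → A → ℝ) (beta : S → ℝ) : ℕ → S → ℝ
  | 0 => beta
  | t + 1 => fun s' => ∑ s, ∑ a, betaT T pi beta t s * pi s a * T s a s'

/-- The discounted occupancy `d^π(s,a) = (1−γ) ∑_t γ^t β_t(s) π(a|s)`. -/
noncomputable def dPi {S A : Type*} [Fintype S] [Fintype A]
    (γ : ℝ) (T : S → A → S → ℝ) (pi : S → A → ℝ) (beta : S → ℝ) (s : S) (a : A) : ℝ :=
  (1 - γ) * ∑' t : ℕ, γ ^ t * betaT T pi beta t s * pi s a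


/-- The (reward-free) expected Bellman operator
`(B^π ν)(s,a) = γ ∑_{s'} T(s'|s,a) ∑_{a'} π(a'|s') ν(s',a')`. -/
noncomputable def Bpi {S A : Type*} [Fintype S] [Fintype A]
    (γ : ℝ) (T : S → A → S → ℝ) (pi : S → A → ℝ) (ν : S → A → ℝ) (s : S) (a : A) : ℝ :=
  γ * ∑ s', T s a s' * ∑ a', pi s' a' * ν s' a'

theorem Bpi_add_smul {S A : Type*} [Fintype S] [Fintype A]
    (γ : ℝ) (T : S → A → S → ℝ) (pi : S → A → ℝ) (c : ℝ) (ν μ : S → A → ℝ) (s : S) (a : A) :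
    Bpi γ T pi (fun s a => ν s a + c * μ s a) s a
      = Bpi γ T pi ν s a + c * Bpi γ T pi μ s a := by
  unfold Bpi
  have h : ∀ s', ∑ a', pi s' a' * (ν s' a' + c * μ s' a')
      = ∑ a', pi s' a' * ν s' a' + c * ∑ a', pi s' a' * μ s' a' := by
    intro s'
    rw [Finset.mul_sum, ← Finset.sum_add_distrib]
    exact Finset.sum_congr rfl fun _ _ => by ring
  simp only [h]
  simp only [mul_add, Finset.sum_add_distrib]
  congr 1
  rw [mul_left_comm, Finset.mul_sum (a := c)]
  congr 1
  exact Finset.sum_congr rfl fun _ _ => by ring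

/-- `I - B^π` as a linear map. -/
noncomputable def resid {S A : Type*} [Fintype S] [Fintype A]
    (γ : ℝ) (T : S → A → S → ℝ) (pi : S → A → ℝ) : (S → A → ℝ) →ₗ[ℝ] (S → A → ℝ) where
  toFun ν := fun s a => ν s a - Bpi γ T pi ν s a
  map_add' ν μ := by
    funext s a
    have := Bpi_add_smul γ T pi 1 ν μ s a
    simp only [one_mul] at this
    change ν s a + μ s a - Bpi γ T pi (fun s a => ν s a + μ s a) s a = (ν s a - _) + (μ s a - _)
    rw [this]; ring
  map_smul' c μ := by
    funext s a
    have h0 := Bpi_add_smul γ T pi c (fun _ _ => 0) μ s a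
    have h1 : Bpi γ T pi (fun _ _ => 0) s a = 0 := by simp [Bpi]
    simp only [zero_add, h1] at h0
    change c * μ s a - Bpi γ T pi (fun s a => c * μ s a) s a = c * (μ s a - _)
    rw [h0]; ring

/-- The equation `ν = f + B^π ν` has exactly one solution. -/
theorem existsUnique_fixed {S A : Type*} [Fintype S] [Fintype A] [Nonempty S] [Nonempty A]
    (T : S → A → S → ℝ) (pi : S → A → ℝ) (γ : ℝ)
    (hT0 : ∀ s a s', 0 ≤ T s a s') (hT1 : ∀ s a, ∑ s', T s a s' = 1)
    (hpi0 : ∀ s a, 0 ≤ pi s a) (hpi1 : ∀ s, ∑ a, pi s a = 1)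
    (hγ0 : 0 ≤ γ) (hγ1 : γ < 1) (f : S → A → ℝ) :
    ∃! ν : S → A → ℝ, ∀ s a, ν s a = f s a + Bpi γ T pi ν s a := by
  have hinj : Function.Injective (resid γ T pi) := by
    rw [← LinearMap.ker_eq_bot, LinearMap.ker_eq_bot']
    intro ν hν
    have hν' : ∀ s a, ν s a = Bpi γ T pi ν s a := fun s a =>
      sub_eq_zero.1 (congrFun (congrFun hν s) a)
    obtain ⟨p, hp⟩ := Finite.exists_max (fun p : S × A => |ν p.1 p.2|)
    set M := |ν p.1 p.2| with hM
    have hV : ∀ s', |∑ a', pi s' a' * ν s' a'| ≤ M := by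
      intro s'
      calc _ ≤ ∑ a', |pi s' a' * ν s' a'| := Finset.abs_sum_le_sum_abs _ _
        _ ≤ ∑ a', pi s' a' * M := Finset.sum_le_sum fun a' _ => by
            rw [abs_mul, abs_of_nonneg (hpi0 _ _)]
            exact mul_le_mul_of_nonneg_left (hp (s', a')) (hpi0 _ _)
        _ = M := by rw [← Finset.sum_mul, hpi1, one_mul]
    have hB : ∀ s a, |Bpi γ T pi ν s a| ≤ γ * M := by
      intro s a
      unfold Bpi
      rw [abs_mul, abs_of_nonneg hγ0]
      refine mul_le_mul_of_nonneg_left ?_ hγ0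
      calc _ ≤ ∑ s', |T s a s' * ∑ a', pi s' a' * ν s' a'| := Finset.abs_sum_le_sum_abs _ _
        _ ≤ ∑ s', T s a s' * M := Finset.sum_le_sum fun s' _ => by
            rw [abs_mul, abs_of_nonneg (hT0 _ _ _)]
            exact mul_le_mul_of_nonneg_left (hV s') (hT0 _ _ _)
        _ = M := by rw [← Finset.sum_mul, hT1, one_mul]
    have h1 : M ≤ γ * M := by
      have := hB p.1 p.2
      rwa [← hν'] at this
    have h2 : M ≤ 0 := by nlinarith [abs_nonneg (ν p.1 p.2)]
    funext s a
    exact abs_nonpos_iff.1 ((hp (s, a)).trans h2)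
  have hsurj := LinearMap.injective_iff_surjective.1 hinj
  obtain ⟨ν, hν⟩ := hsurj f
  refine ⟨ν, fun s a => ?_, fun μ hμ => hinj ?_⟩
  · have : ν s a - Bpi γ T pi ν s a = f s a := congrFun (congrFun hν s) a
    linarith
  · rw [hν]
    funext s a
    change μ s a - Bpi γ T pi μ s a = f s a
    linarith [hμ s a]

theorem betaT_nonneg {S A : Type*} [Fintype S] [Fintype A]
    (T : S → A → S → ℝ) (pi : S → A → ℝ) (beta : S → ℝ)
    (hT0 : ∀ s a s', 0 ≤ T s a s') (hpi0 : ∀ s a, 0 ≤ pi s a) (hbeta0 : ∀ s, 0 ≤ beta s)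
    (t : ℕ) : ∀ s, 0 ≤ betaT T pi beta t s := by
  induction t with
  | zero => exact hbeta0
  | succ t ih =>
    intro s'
    exact Finset.sum_nonneg fun s _ => Finset.sum_nonneg fun a _ =>
      mul_nonneg (mul_nonneg (ih s) (hpi0 _ _)) (hT0 _ _ _)

theorem betaT_sum {S A : Type*} [Fintype S] [Fintype A]
    (T : S → A → S → ℝ) (pi : S → A → ℝ) (beta : S → ℝ)
    (hT1 : ∀ s a, ∑ s', T s a s' = 1) (hpi1 : ∀ s, ∑ a, pi s a = 1)
    (hbeta1 : ∑ s, beta s = 1) (t : ℕ) : ∑ s, betaT T pi beta t s = 1 := by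
  induction t with
  | zero => exact hbeta1
  | succ t ih =>
    simp only [betaT]
    rw [Finset.sum_comm, ← ih]
    refine Finset.sum_congr rfl fun s _ => ?_
    rw [Finset.sum_comm]
    simp only [← Finset.mul_sum, hT1, hpi1, mul_one]

theorem dPi_identity {S A : Type*} [Fintype S] [Fintype A]
    (T : S → A → S → ℝ) (pi : S → A → ℝ) (beta : S → ℝ) (γ : ℝ)
    (hT0 : ∀ s a s', 0 ≤ T s a s') (hT1 : ∀ s a, ∑ s', T s a s' = 1)
    (hpi0 : ∀ s a, 0 ≤ pi s a) (hpi1 : ∀ s, ∑ a, pi s a = 1)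
    (hbeta0 : ∀ s, 0 ≤ beta s) (hbeta1 : ∑ s, beta s = 1)
    (hγ0 : 0 ≤ γ) (hγ1 : γ < 1) (ν : S → A → ℝ) :
    ∑ s, ∑ a, dPi γ T pi beta s a * (ν s a - Bpi γ T pi ν s a)
      = (1 - γ) * ∑ s, ∑ a, beta s * pi s a * ν s a := by
  have hsum : ∀ s, Summable fun t : ℕ => γ ^ t * betaT T pi beta t s := by
    intro s
    refine Summable.of_nonneg_of_le
      (fun t => mul_nonneg (pow_nonneg hγ0 t) (betaT_nonneg T pi beta hT0 hpi0 hbeta0 t s))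
      (fun t => ?_) (summable_geometric_of_lt_one hγ0 hγ1)
    refine mul_le_of_le_one_right (pow_nonneg hγ0 t) ?_
    rw [← betaT_sum T pi beta hT1 hpi1 hbeta1 t]
    exact Finset.single_le_sum
      (fun i _ => betaT_nonneg T pi beta hT0 hpi0 hbeta0 t i) (Finset.mem_univ s)
  set D : S → ℝ := fun s => ∑' t : ℕ, γ ^ t * betaT T pi beta t s with hD
  have hd : ∀ s a, dPi γ T pi beta s a = (1 - γ) * (D s * pi s a) := by
    intro s a
    simp only [dPi, hD, tsum_mul_right]
  have hrec : ∀ s', D s' = beta s' + γ * ∑ s, ∑ a, D s * pi s a * T s a s' := by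
    intro s'
    have h1 : D s' = γ ^ 0 * betaT T pi beta 0 s'
        + ∑' t : ℕ, γ ^ (t + 1) * betaT T pi beta (t + 1) s' := (hsum s').tsum_eq_zero_add
    have h2 : HasSum (fun t : ℕ => γ ^ (t + 1) * betaT T pi beta (t + 1) s')
        (γ * ∑ s, ∑ a, D s * pi s a * T s a s') := by
      have h3 : HasSum (fun t : ℕ => γ * ∑ s, ∑ a, (γ ^ t * betaT T pi beta t s) * pi s a * T s a s')
          (γ * ∑ s, ∑ a, D s * pi s a * T s a s') :=
        (hasSum_sum fun s _ => hasSum_sum fun a _ =>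
          ((hsum s).hasSum.mul_right _).mul_right _).mul_left _
      convert h3 using 2 with t
      simp only [betaT, Finset.mul_sum]
      exact Finset.sum_congr rfl fun s _ => Finset.sum_congr rfl fun a _ => by ring
    rw [h1, h2.tsum_eq]
    simp [betaT]
  have hB : ∑ s, ∑ a, D s * pi s a * Bpi γ T pi ν s a
      = ∑ s', (D s' - beta s') * ∑ a', pi s' a' * ν s' a' := by
    have h4 : ∀ s', D s' - beta s' = ∑ s, ∑ a, γ * (D s * pi s a * T s a s') := by
      intro s'
      have := hrec s'
      simp only [Finset.mul_sum] at this
      linarith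
    simp only [h4]
    simp only [Finset.sum_mul]
    symm
    rw [Finset.sum_comm]
    refine Finset.sum_congr rfl fun s _ => ?_
    rw [Finset.sum_comm]
    refine Finset.sum_congr rfl fun a _ => ?_
    simp only [Bpi]
    rw [Finset.mul_sum (a := γ), Finset.mul_sum]
    exact Finset.sum_congr rfl fun s' _ => by ring
  have h5 : ∑ s, ∑ a, dPi γ T pi beta s a * (ν s a - Bpi γ T pi ν s a)
      = (1 - γ) * (∑ s, ∑ a, D s * pi s a * ν s a
          - ∑ s, ∑ a, D s * pi s a * Bpi γ T pi ν s a) := by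
    simp only [hd, ← Finset.sum_sub_distrib, Finset.mul_sum]
    exact Finset.sum_congr rfl fun s _ => Finset.sum_congr rfl fun a _ => by ring
  rw [h5, hB, ← Finset.sum_sub_distrib]
  congr 1
  refine Finset.sum_congr rfl fun s _ => ?_
  rw [Finset.mul_sum, ← Finset.sum_sub_distrib]
  exact Finset.sum_congr rfl fun a _ => by ring

theorem saddle_point_exists_and_dual_equals_correction
    {S A : Type*} [Fintype S] [Fintype A] [Nonempty S] [Nonempty A]
    (T : S → A → S → ℝ) (pi : S → A → ℝ) (beta : S → ℝ) (γ : ℝ) (dD : S → A → ℝ)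
    (hT0 : ∀ s a s', 0 ≤ T s a s') (hT1 : ∀ s a, ∑ s', T s a s' = 1)
    (hpi0 : ∀ s a, 0 ≤ pi s a) (hpi1 : ∀ s, ∑ a, pi s a = 1)
    (hbeta0 : ∀ s, 0 ≤ beta s) (hbeta1 : ∑ s, beta s = 1)
    (hγ0 : 0 ≤ γ) (hγ1 : γ < 1)
    (hdD0 : ∀ s a, 0 < dD s a) (hdD1 : ∑ s, ∑ a, dD s a = 1)
    (w : S → A → ℝ) (hw : ∀ s a, w s a = dPi γ T pi beta s a / dD s a)
    (Jmm : (S → A → ℝ) → (S → A → ℝ) → ℝ)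
    (hJmm : ∀ ν ζ : S → A → ℝ,
      Jmm ν ζ = (∑ s, ∑ a, dD s a *
                    ((ν s a - Bpi γ T pi ν s a) * ζ s a - (1 / 2) * (ζ s a) ^ 2))
                  - (1 - γ) * ∑ s, ∑ a, beta s * pi s a * ν s a) :
    (∀ νstar : S → A → ℝ,
        (∀ s a, νstar s a = w s a + Bpi γ T pi νstar s a) →
        ∀ ν ζ : S → A → ℝ, Jmm νstar ζ ≤ Jmm νstar w ∧ Jmm νstar w ≤ Jmm ν w) ∧
      (∀ νstar ζstar : S → A → ℝ,
        (∀ ν ζ : S → A → ℝ, Jmm νstar ζ ≤ Jmm νstar ζstar ∧ Jmm νstar ζstar ≤ Jmm ν ζstar) →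
        ∀ s a, ζstar s a = w s a) := by
  have hid := dPi_identity T pi beta γ hT0 hT1 hpi0 hpi1 hbeta0 hbeta1 hγ0 hγ1
  have hdw : ∀ s a, dPi γ T pi beta s a = dD s a * w s a := by
    intro s a
    rw [hw, mul_div_cancel₀ _ (hdD0 s a).ne']
  simp only [hdw] at hid
  constructor
  · intro νstar hfix ν ζ
    constructor
    · rw [hJmm, hJmm]
      refine sub_le_sub_right (Finset.sum_le_sum fun s _ => Finset.sum_le_sum fun a _ =>
        mul_le_mul_of_nonneg_left ?_ (hdD0 s a).le) _
      have h : νstar s a - Bpi γ T pi νstar s a = w s a := by linarith [hfix s a]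
      rw [h]
      nlinarith [sq_nonneg (w s a - ζ s a)]
    · have hc : ∀ μ : S → A → ℝ, Jmm μ w = - ∑ s, ∑ a, dD s a * ((1 / 2) * (w s a) ^ 2) := by
        intro μ
        rw [hJmm, ← hid μ, ← Finset.sum_sub_distrib, ← Finset.sum_neg_distrib]
        refine Finset.sum_congr rfl fun s _ => ?_
        rw [← Finset.sum_sub_distrib, ← Finset.sum_neg_distrib]
        exact Finset.sum_congr rfl fun a _ => by ring
      rw [hc, hc]
  · intro νstar ζstar hsad
    have hlin : ∀ μ : S → A → ℝ,
        ∑ s, ∑ a, dD s a * (ζstar s a - w s a) * (μ s a - Bpi γ T pi μ s a) = 0 := by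
      intro μ
      set L := ∑ s, ∑ a, dD s a * (ζstar s a - w s a) * (μ s a - Bpi γ T pi μ s a) with hL
      have hJ : ∀ η : S → A → ℝ, Jmm η ζstar
          = ∑ s, ∑ a, (dD s a * (ζstar s a - w s a) * (η s a - Bpi γ T pi η s a)
              - dD s a * ((1 / 2) * (ζstar s a) ^ 2)) := by
        intro η
        rw [hJmm, ← hid η, ← Finset.sum_sub_distrib]
        refine Finset.sum_congr rfl fun s _ => ?_
        rw [← Finset.sum_sub_distrib]
        exact Finset.sum_congr rfl fun a _ => by ring
      have h1 : ∀ c : ℝ, Jmm (fun s a => νstar s a + c * μ s a) ζstar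
          = Jmm νstar ζstar + c * L := by
        intro c
        rw [hJ, hJ, hL]
        simp only [Bpi_add_smul, Finset.mul_sum, ← Finset.sum_add_distrib]
        exact Finset.sum_congr rfl fun s _ => Finset.sum_congr rfl fun a _ => by ring
      have h2 := (hsad (fun s a => νstar s a + (-L) * μ s a) ζstar).2
      rw [h1] at h2
      have : L * L ≤ 0 := by linarith
      exact mul_self_eq_zero.1 (le_antisymm this (mul_self_nonneg L))
    obtain ⟨μ, hμ, -⟩ := existsUnique_fixed T pi γ hT0 hT1 hpi0 hpi1 hγ0 hγ1
      (fun s a => ζstar s a - w s a)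
    have h0 := hlin μ
    have hμ' : ∀ s a, μ s a - Bpi γ T pi μ s a = ζstar s a - w s a := fun s a => by
      linarith [hμ s a]
    simp only [hμ'] at h0
    have hnn : ∀ s a, 0 ≤ dD s a * (ζstar s a - w s a) * (ζstar s a - w s a) := fun s a => by
      rw [mul_assoc]
      exact mul_nonneg (hdD0 s a).le (mul_self_nonneg _)
    intro s a
    have h3 := (Finset.sum_eq_zero_iff_of_nonneg
      (fun s _ => Finset.sum_nonneg fun a _ => hnn s a)).1 h0 s (Finset.mem_univ s)
    have h4 := (Finset.sum_eq_zero_iff_of_nonneg (fun a _ => hnn s a)).1 h3 a (Finset.mem_univ a)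
    rw [mul_assoc] at h4
    rcases mul_eq_zero.1 h4 with h | h
    · exact absurd h (hdD0 s a).ne'
    · exact sub_eq_zero.1 (mul_self_eq_zero.1 h)
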